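/- For every ξ₋ ∈ J ∩ ᶜK and ξ₊ ∈ X⁻¹O ∩ ᶜK one has 1/ξ₋ − [1/ξ₊] ∈ J ∩ ᶜK and Ψ(ξ₊) ∈ X⁻¹O ∩ ᶜK; thus Φ maps Ω into Ω, and Φ is a bijection of Ω which is a homeomorphism for the topology induced by d_∞ × d_∞. -/

import Mathlib

open MeasureTheory
open scoped ENNReal Classical

noncomputable section

namespace ArtinCoding

variable (k : Type*) [Field k] [Fintype k]

/-- The field `K̂ = k((X⁻¹))` of formal Laurent series in `X⁻¹` over `k`, realized as the
field of formal Laurent series `k((t))` in the variable `t = X⁻¹`. -/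
abbrev Khat := LaurentSeries k

variable {k}

/-- The absolute value `|f|_∞ = q^{-v_∞(f)}`, where `v_∞` is the order of vanishing in the
variable `t = X⁻¹` (so a nonzero polynomial in `X` has absolute value `≥ 1`). -/
def absInf (f : Khat k) : ℝ :=
  if f = 0 then 0 else (Fintype.card k : ℝ) ^ (-f.order)

lemma absInf_nonneg (f : Khat k) : 0 ≤ absInf f := by
  unfold absInf
  split
  · exact le_refl 0
  · positivity

lemma absInf_eq_zero {f : Khat k} : absInf f = 0 ↔ f = 0 := by
  constructor
  · intro h
    by_contra hf
    have hq : (0:ℝ) < (Fintype.card k : ℝ) := by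
      have := Fintype.card_pos (α := k); positivity
    rw [absInf, if_neg hf] at h
    exact absurd h (ne_of_gt (zpow_pos hq _))
  · intro h; simp [absInf, h]

lemma absInf_neg (f : Khat k) : absInf (-f) = absInf f := by
  unfold absInf
  rw [neg_eq_zero, HahnSeries.order_neg]

lemma absInf_add_le (f g : Khat k) : absInf (f + g) ≤ max (absInf f) (absInf g) := by
  rcases eq_or_ne (f + g) 0 with h | h
  · rw [show absInf (f+g) = 0 by rw [absInf_eq_zero]; exact h]
    exact le_max_of_le_left (absInf_nonneg f)
  rcases eq_or_ne f 0 with hf | hf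
  · simp [hf]
  rcases eq_or_ne g 0 with hg | hg
  · simp [hg]
  have hmin := HahnSeries.min_order_le_order_add h
  have hq : (1:ℝ) ≤ (Fintype.card k : ℝ) := by
    exact_mod_cast Nat.one_le_iff_ne_zero.mpr Fintype.card_ne_zero
  rw [absInf, if_neg h]
  rcases le_total f.order g.order with hod | hod
  · rw [min_eq_left hod] at hmin
    refine le_max_of_le_left ?_
    rw [absInf, if_neg hf]
    exact zpow_le_zpow_right₀ hq (neg_le_neg hmin)
  · rw [min_eq_right hod] at hmin
    refine le_max_of_le_right ?_
    rw [absInf, if_neg hg]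
    exact zpow_le_zpow_right₀ hq (neg_le_neg hmin)

/-- The metric `d_∞(f,g) = |f-g|_∞` on `K̂`. -/
noncomputable instance : MetricSpace (Khat k) where
  dist f g := absInf (f - g)
  dist_self f := by simp [absInf]
  dist_comm f g := by
    have : g - f = -(f - g) := by ring
    show absInf (f - g) = absInf (g - f)
    rw [this, absInf_neg]
  dist_triangle f g h := by
    show absInf (f - h) ≤ absInf (f - g) + absInf (g - h)
    have key : absInf (f - h) ≤ max (absInf (f - g)) (absInf (g - h)) := by
      have : f - h = (f - g) + (g - h) := by ring
      rw [this]; exact absInf_add_le _ _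
    exact key.trans (max_le_add_of_nonneg (absInf_nonneg _) (absInf_nonneg _))
  eq_of_dist_eq_zero := by
    intro f g h
    have : f - g = 0 := absInf_eq_zero.mp h
    exact sub_eq_zero.mp this

/- Make sure the topology coming from the metric `d_∞` is the one used everywhere
(the valued-field uniformity on Laurent series induces the same topology). -/
instance (priority := 10000) : UniformSpace (Khat k) := PseudoMetricSpace.toUniformSpace
instance (priority := 10000) : TopologicalSpace (Khat k) := UniformSpace.toTopologicalSpace

instance : MeasurableSpace (Khat k) := borel _
instance : BorelSpace (Khat k) := ⟨rfl⟩

variable (k)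

/-- The element `X⁻¹` of `K̂` (the uniformizer `t`). -/
def Xinv : Khat k := HahnSeries.single (1 : ℤ) (1 : k)

/-- The element `X` of `K̂`. -/
def Xel : Khat k := HahnSeries.single (-1 : ℤ) (1 : k)

/-- The valuation ring `O = k[[X⁻¹]] = {f : |f|_∞ ≤ 1}`. -/
def Oball : Set (Khat k) := {f | absInf f ≤ 1}

/-- The set `X⁻¹O`, i.e. the maximal ideal of `O`. -/
def XinvO : Set (Khat k) := (fun f => Xinv k * f) '' Oball k

/-- The ring `A = k[X]` of polynomials in `X`, viewed as a subset of `K̂`. -/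
def Aset : Set (Khat k) := Set.range fun p : Polynomial k => Polynomial.aeval (Xel k) p

/-- The constants `k ⊆ K̂`. -/
def kconsts : Set (Khat k) := Set.range (algebraMap k (Khat k))

/-- The set `A∖k` of nonconstant polynomials in `X`, viewed inside `K̂`. -/
def AmK : Set (Khat k) := Aset k \ kconsts k

/-- The field `K = k(X)` of rational functions, viewed as a subset of `K̂`
(note that `k(X) = k(X⁻¹)` as a subfield of `K̂`). -/
def Kset : Set (Khat k) := Set.range fun r : RatFunc k => (r : LaurentSeries k)

/-- The set `ᶜK = K̂ ∖ K` of irrational elements. -/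
def cK : Set (Khat k) := (Kset k)ᶜ

variable {k}

/-- The integer part `[f] ∈ A = k[X]` of `f ∈ K̂`: the sum of the terms of `f` with
nonpositive exponents in `t = X⁻¹`. -/
def intPart (f : Khat k) : Khat k :=
  ∑ i ∈ Finset.Icc (min f.order 0) 0, HahnSeries.single i (f.coeff i)

/-- The fractional part `{f} = f - [f] ∈ X⁻¹O` of `f ∈ K̂`. -/
def fracPart (f : Khat k) : Khat k := f - intPart f

/-- The Artin map `Ψ(f) = 1/f - [1/f]`. -/
def ArtinPsi (f : Khat k) : Khat k := fracPart f⁻¹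

/-- The Artin continued fraction digit `a_{n+1}(f) = [1/Ψⁿ(f)]` (for `n : ℕ`, so that
`digit 0 f = a₁(f) = [1/f]`). -/
def digit (n : ℕ) (f : Khat k) : Khat k := intPart ((ArtinPsi (k := k))^[n] f)⁻¹

variable (k)

/-- The set `J = ⋃_{a ∈ A∖k} (a + X⁻¹O)`. -/
def Jset : Set (Khat k) := ⋃ a ∈ AmK k, (fun x => a + x) '' XinvO k

/-- The domain `Ω = (J ∩ ᶜK) × (X⁻¹O ∩ ᶜK)` of the natural extension of the Artin map. -/
def OmegaSet : Set (Khat k × Khat k) := (Jset k ∩ cK k) ×ˢ (XinvO k ∩ cK k)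

variable {k}

/-- The map `Φ(ξ₋, ξ₊) = (1/ξ₋ - [1/ξ₊], Ψ(ξ₊))` (as a globally defined map on `K̂ × K̂`). -/
def PhiRaw (p : Khat k × Khat k) : Khat k × Khat k :=
  (p.1⁻¹ - intPart p.2⁻¹, ArtinPsi p.2)

/-- The coding map `Θ'` sending `(ξ₋, ξ₊)` to the bilateral sequence `(c_n)_{n ∈ ℤ}` with
`c_n = a_n(ξ₊)` for `n ≥ 1` and `c_{-n} = a_{n+1}(-1/ξ₋)` for `n ≥ 0`. -/
def ThetaRaw (p : Khat k × Khat k) : ℤ → Khat k := fun n =>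
  if 1 ≤ n then digit (n - 1).toNat p.2 else digit (-n).toNat (-p.1⁻¹)

variable (k)

/-- The density `q²/|ξ₊ - ξ₋|²_∞`. -/
def dens (p : Khat k × Khat k) : ℝ≥0∞ :=
  ENNReal.ofReal ((Fintype.card k : ℝ) ^ 2 * ((absInf (p.2 - p.1)) ^ 2)⁻¹)

/-- The measure `m̂` on `Ω` given by `dm̂(ξ₋,ξ₊) = q² dμ(ξ₋) dμ(ξ₊)/|ξ₊ - ξ₋|²_∞`. -/
def mhat (μ : Measure (Khat k)) : Measure (Khat k × Khat k) :=
  (((μ.prod μ).withDensity (dens k))).restrict (OmegaSet k)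

/-- The weight `ν(a) = |a|_∞⁻² = q^{-2 deg a}` for `a ∈ A∖k` (and `0` otherwise),
with values in `ℝ≥0∞`. -/
def nuE (a : Khat k) : ℝ≥0∞ :=
  if a ∈ AmK k then ENNReal.ofReal (((absInf a) ^ 2)⁻¹) else 0

section Order

variable {k}

lemma one_lt_card_real : (1 : ℝ) < Fintype.card k := by
  exact_mod_cast Fintype.one_lt_card (α := k)

lemma absInf_mul (f g : Khat k) : absInf (f * g) = absInf f * absInf g := by
  rcases eq_or_ne f 0 with rfl | hf
  · simp [absInf]
  rcases eq_or_ne g 0 with rfl | hg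
  · simp [absInf]
  have hq : (Fintype.card k : ℝ) ≠ 0 := (zero_lt_one.trans one_lt_card_real).ne'
  rw [absInf, absInf, absInf, if_neg hf, if_neg hg, if_neg (mul_ne_zero hf hg),
    HahnSeries.order_mul hf hg, neg_add, zpow_add₀ hq]

lemma absInf_one : absInf (1 : Khat k) = 1 := by
  simp [absInf]

lemma absInf_inv (f : Khat k) : absInf f⁻¹ = (absInf f)⁻¹ := by
  rcases eq_or_ne f 0 with rfl | hf
  · simp [absInf]
  refine eq_inv_of_mul_eq_one_left ?_
  rw [← absInf_mul, inv_mul_cancel₀ hf, absInf_one]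

lemma absInf_le_zpow_iff (f : Khat k) (n : ℤ) :
    absInf f ≤ (Fintype.card k : ℝ) ^ (-n) ↔ ∀ i < n, f.coeff i = 0 := by
  rcases eq_or_ne f 0 with rfl | hf
  · simp only [absInf, if_true, HahnSeries.coeff_zero, implies_true, iff_true]
    positivity
  · rw [absInf, if_neg hf, zpow_le_zpow_iff_right₀ one_lt_card_real, neg_le_neg_iff,
      HahnSeries.le_order_iff_forall hf]

lemma absInf_le_one_iff {f : Khat k} : absInf f ≤ 1 ↔ ∀ i < 0, f.coeff i = 0 := by
  simpa using absInf_le_zpow_iff f 0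

lemma absInf_lt_one_iff {f : Khat k} : absInf f < 1 ↔ ∀ i ≤ 0, f.coeff i = 0 := by
  rcases eq_or_ne f 0 with rfl | hf
  · simp [absInf]
  · have h := zpow_lt_zpow_iff_right₀ (n := 0) (m := -f.order) (one_lt_card_real (k := k))
    rw [zpow_zero] at h
    rw [absInf, if_neg hf, h, neg_lt_zero, ← Int.add_one_le_iff,
      HahnSeries.le_order_iff_forall hf]
    exact forall_congr' fun i => by rw [zero_add, ← zero_add (1 : ℤ), Int.lt_add_one_iff]

lemma one_lt_absInf_iff {f : Khat k} : 1 < absInf f ↔ ∃ i < 0, f.coeff i ≠ 0 := by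
  rw [← not_le, absInf_le_one_iff]
  push Not
  rfl

lemma one_lt_absInf_inv_iff {f : Khat k} (hf : f ≠ 0) : 1 < absInf f⁻¹ ↔ absInf f < 1 := by
  have : 0 < absInf f := (absInf_nonneg f).lt_of_ne' (absInf_eq_zero.not.2 hf)
  rw [absInf_inv, one_lt_inv₀ this]

lemma absInf_inv_lt_one {f : Khat k} (hf : 1 < absInf f) : absInf f⁻¹ < 1 := by
  rw [absInf_inv]
  exact inv_lt_one_of_one_lt₀ hf

end Order

section NormedField

variable {k}

/-- The field `K̂` normed by `|·|_∞`. -/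
abbrev normedField : NormedField (Khat k) where
  norm := absInf
  dist_eq f g := by
    rw [neg_add_eq_sub, ← absInf_neg (g - f), neg_sub]
    rfl
  norm_mul := absInf_mul

lemma continuous_sub_Khat : Continuous fun p : Khat k × Khat k => p.1 - p.2 :=
  letI := normedField (k := k)
  continuous_sub

lemma continuousAt_inv_Khat {f : Khat k} (hf : f ≠ 0) : ContinuousAt Inv.inv f :=
  letI := normedField (k := k)
  continuousAt_inv₀ hf

end NormedField

section Algebraic

variable {F : Type*} [Field F]

lemma coeff_intPart (f : Khat F) (i : ℤ) :
    (intPart f).coeff i = if i ≤ 0 then f.coeff i else 0 := by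
  rw [intPart, HahnSeries.coeff_sum]
  have hne : ∀ j ≠ i, (HahnSeries.single j (f.coeff j)).coeff i = 0 := fun j hj =>
    HahnSeries.coeff_single_of_ne hj.symm
  by_cases hmem : i ∈ Finset.Icc (min f.order 0) 0
  · rw [Finset.sum_eq_single_of_mem i hmem fun j _ => hne j, HahnSeries.coeff_single_same,
      if_pos (Finset.mem_Icc.1 hmem).2]
  · rw [Finset.sum_eq_zero fun j hj => hne j (ne_of_mem_of_not_mem hj hmem)]
    split_ifs with hi
    · refine (HahnSeries.coeff_eq_zero_of_lt_order ?_).symm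
      by_contra! ho
      exact hmem (Finset.mem_Icc.2 ⟨min_le_of_left_le ho, hi⟩)
    · rfl

lemma intPart_add (f g : Khat F) : intPart (f + g) = intPart f + intPart g := by
  ext i
  simp only [HahnSeries.coeff_add, coeff_intPart]
  split <;> simp

lemma intPart_neg (f : Khat F) : intPart (-f) = -intPart f := by
  ext i
  simp only [HahnSeries.coeff_neg, coeff_intPart]
  split <;> simp

lemma intPart_sub (f g : Khat F) : intPart (f - g) = intPart f - intPart g := by
  rw [sub_eq_add_neg, intPart_add, intPart_neg, sub_eq_add_neg]

lemma intPart_intPart (f : Khat F) : intPart (intPart f) = intPart f := by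
  ext i
  simp only [coeff_intPart]
  split <;> simp

lemma algebraMap_eq_single (c : F) : algebraMap F (Khat F) c = HahnSeries.single 0 c := by
  rw [HahnSeries.algebraMap_apply']
  simp

lemma aeval_Xel_monomial (n : ℕ) (c : F) :
    Polynomial.aeval (Xel F) (Polynomial.monomial n c) = HahnSeries.single (-n : ℤ) c := by
  rw [Polynomial.aeval_monomial, Xel, HahnSeries.single_pow, algebraMap_eq_single,
    HahnSeries.single_mul_single]
  simp

lemma coeff_aeval_Xel (p : Polynomial F) (n : ℕ) :
    (Polynomial.aeval (Xel F) p).coeff (-n : ℤ) = p.coeff n := by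
  induction p using Polynomial.induction_on' with
  | add p q hp hq => rw [map_add, HahnSeries.coeff_add, hp, hq, Polynomial.coeff_add]
  | monomial m c =>
    rw [aeval_Xel_monomial, HahnSeries.coeff_single, Polynomial.coeff_monomial]
    simp [eq_comm]

lemma intPart_mem_Aset (f : Khat F) : intPart f ∈ Aset F := by
  change intPart f ∈ (Polynomial.aeval (R := F) (Xel F)).range
  refine sum_mem fun i hi => ⟨Polynomial.monomial (-i).toNat (f.coeff i), ?_⟩
  have : (-((-i).toNat : ℤ)) = i := by
    have := (Finset.mem_Icc.1 hi).2
    lia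
  exact (aeval_Xel_monomial _ _).trans (by rw [this])

end Algebraic

section IntPart

variable {k}

lemma absInf_fracPart_lt_one (f : Khat k) : absInf (fracPart f) < 1 := by
  rw [absInf_lt_one_iff]
  intro i hi
  rw [fracPart, HahnSeries.coeff_sub, coeff_intPart, if_pos hi, sub_self]

lemma intPart_eq_zero_iff {f : Khat k} : intPart f = 0 ↔ absInf f < 1 := by
  rw [absInf_lt_one_iff, HahnSeries.ext_iff, funext_iff]
  simp [coeff_intPart]

lemma one_lt_absInf_intPart_iff {f : Khat k} : 1 < absInf (intPart f) ↔ 1 < absInf f := by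
  simp only [one_lt_absInf_iff, coeff_intPart]
  refine exists_congr fun i => and_congr_right fun hi => ?_
  rw [if_pos hi.le]

lemma one_lt_absInf_sub {f g : Khat k} (hf : absInf f < 1) (hg : 1 < absInf g) :
    1 < absInf (f - g) := by
  by_contra! h
  have h' := absInf_add_le f (-(f - g))
  rw [absInf_neg, ← sub_eq_add_neg, sub_sub_cancel] at h'
  exact (h'.trans (max_le hf.le h)).not_gt hg

lemma continuous_intPart : Continuous (intPart : Khat k → Khat k) := by
  refine IsLocallyConstant.continuous ((IsLocallyConstant.iff_eventually_eq _).2 fun f => ?_)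
  filter_upwards [Metric.ball_mem_nhds f one_pos] with g hg
  have h : absInf (g - f) < 1 := hg
  rwa [← sub_eq_zero, ← intPart_sub, intPart_eq_zero_iff]

lemma continuous_fracPart : Continuous (fracPart : Khat k → Khat k) :=
  continuous_sub_Khat.comp (continuous_id.prodMk continuous_intPart)

end IntPart

section RationalSubfield

open scoped RatFunc

variable {F : Type*} [Field F]

variable (F) in
/-- The field `K = k(X)` as a subfield of `K̂`. -/
def KSubfield : Subfield (Khat F) := (algebraMap (RatFunc F) (Khat F)).fieldRange

lemma mem_KSubfield_iff {f : Khat F} : f ∈ KSubfield F ↔ f ∈ Kset F := Iff.rfl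

lemma single_mem_KSubfield (n : ℤ) (c : F) : HahnSeries.single n c ∈ KSubfield F := by
  have hX : HahnSeries.single (1 : ℤ) (1 : F) ∈ KSubfield F := ⟨RatFunc.X, RatFunc.coe_X⟩
  have hC : HahnSeries.single (0 : ℤ) c ∈ KSubfield F := by
    refine ⟨RatFunc.C c, ?_⟩
    rw [← RatFunc.algebraMap_C, ← IsScalarTower.algebraMap_apply]
    simp [Polynomial.algebraMap_hahnSeries_apply]
  have := mul_mem hC (zpow_mem hX n)
  rwa [← RatFunc.single_zpow, HahnSeries.single_mul_single, zero_add, mul_one] at this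

lemma ne_zero_of_mem_cK {f : Khat F} (hf : f ∈ cK F) : f ≠ 0 := by
  rintro rfl
  exact hf (zero_mem (KSubfield F))

lemma inv_mem_cK {f : Khat F} (hf : f ∈ cK F) : f⁻¹ ∈ cK F :=
  fun h => hf (inv_mem_iff (H := KSubfield F) |>.1 h)

lemma intPart_mem_KSubfield (f : Khat F) : intPart f ∈ KSubfield F :=
  sum_mem fun _ _ => single_mem_KSubfield _ _

lemma sub_intPart_mem_cK {f : Khat F} (hf : f ∈ cK F) (g : Khat F) : f - intPart g ∈ cK F :=
  fun h => hf (sub_add_cancel f (intPart g) ▸ add_mem (mem_KSubfield_iff.2 h) (intPart_mem_KSubfield g))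

end RationalSubfield

section Sets

variable {k}

lemma mem_XinvO_iff {f : Khat k} : f ∈ XinvO k ↔ absInf f < 1 := by
  have hc : ∀ (g : Khat k) (i : ℤ), (Xinv k * g).coeff i = g.coeff (i - 1) := fun g i => by
    simpa [Xinv] using HahnSeries.coeff_single_mul_add (r := (1 : k)) (x := g) (a := i - 1) (b := 1)
  have hX : Xinv k ≠ 0 := HahnSeries.single_ne_zero one_ne_zero
  constructor
  · rintro ⟨g, hg, rfl⟩
    have hg' := absInf_le_one_iff.1 hg
    refine absInf_lt_one_iff.2 fun i hi => ?_
    rw [hc]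
    exact hg' _ (by lia)
  · intro hf
    have hf' : Xinv k * ((Xinv k)⁻¹ * f) = f := mul_inv_cancel_left₀ hX f
    refine ⟨(Xinv k)⁻¹ * f, absInf_le_one_iff.2 fun i hi => ?_, hf'⟩
    have := hc ((Xinv k)⁻¹ * f) (i + 1)
    rw [hf', add_sub_cancel_right] at this
    rw [← this]
    exact absInf_lt_one_iff.1 hf _ (by lia)

lemma one_lt_absInf_of_mem_AmK {a : Khat k} (ha : a ∈ AmK k) : 1 < absInf a := by
  obtain ⟨⟨p, rfl⟩, hp⟩ := ha
  by_contra! h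
  rw [absInf_le_one_iff] at h
  refine hp ⟨p.coeff 0, ?_⟩
  have : p = Polynomial.C (p.coeff 0) := by
    ext n
    rcases n with _ | n
    · simp
    · rw [Polynomial.coeff_C_succ, ← coeff_aeval_Xel]
      exact h _ (by push_cast; lia)
  change _ = Polynomial.aeval (Xel k) p
  rw [this, Polynomial.aeval_C]
  simp

lemma absInf_le_one_of_mem_kconsts {a : Khat k} (ha : a ∈ kconsts k) : absInf a ≤ 1 := by
  obtain ⟨c, rfl⟩ := ha
  rw [absInf_le_one_iff, algebraMap_eq_single]
  exact fun i hi => HahnSeries.coeff_single_of_ne hi.ne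

lemma mem_Jset_iff {f : Khat k} : f ∈ Jset k ↔ 1 < absInf f := by
  simp only [Jset, Set.mem_iUnion, exists_prop]
  constructor
  · rintro ⟨a, ha, x, hx, rfl⟩
    have := one_lt_absInf_sub (mem_XinvO_iff.1 hx)
      ((absInf_neg a).symm ▸ one_lt_absInf_of_mem_AmK ha)
    rwa [sub_neg_eq_add, add_comm] at this
  · intro hf
    refine ⟨intPart f, ⟨intPart_mem_Aset f, fun h => ?_⟩, fracPart f,
      mem_XinvO_iff.2 (absInf_fracPart_lt_one f), add_sub_cancel _ _⟩
    exact (absInf_le_one_of_mem_kconsts h).not_gt (one_lt_absInf_intPart_iff.2 hf)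

lemma mem_OmegaSet_iff {p : Khat k × Khat k} :
    p ∈ OmegaSet k ↔ (1 < absInf p.1 ∧ p.1 ∈ cK k) ∧ absInf p.2 < 1 ∧ p.2 ∈ cK k := by
  rw [OmegaSet, Set.mem_prod, Set.mem_inter_iff, Set.mem_inter_iff, mem_Jset_iff, mem_XinvO_iff]

end Sets

section Phi

variable {k}

lemma PhiRaw_mem_OmegaSet {p : Khat k × Khat k} (hp : p ∈ OmegaSet k) :
    PhiRaw p ∈ OmegaSet k := by
  obtain ⟨⟨h₁, h₁'⟩, h₂, h₂'⟩ := mem_OmegaSet_iff.1 hp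
  refine mem_OmegaSet_iff.2 ⟨⟨?_, sub_intPart_mem_cK (inv_mem_cK h₁') _⟩,
    absInf_fracPart_lt_one _, sub_intPart_mem_cK (inv_mem_cK h₂') _⟩
  exact one_lt_absInf_sub (absInf_inv_lt_one h₁)
    (one_lt_absInf_intPart_iff.2 ((one_lt_absInf_inv_iff (ne_zero_of_mem_cK h₂')).2 h₂))

/-- The inverse of `PhiRaw` on `Ω`: `(η₋, η₊) ↦ (1/{η₋}, 1/(η₊ - [η₋]))`. -/
def PhiInv (p : Khat k × Khat k) : Khat k × Khat k :=
  ((fracPart p.1)⁻¹, (p.2 - intPart p.1)⁻¹)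

lemma PhiInv_mem_OmegaSet {p : Khat k × Khat k} (hp : p ∈ OmegaSet k) :
    PhiInv p ∈ OmegaSet k := by
  obtain ⟨⟨h₁, h₁'⟩, h₂, h₂'⟩ := mem_OmegaSet_iff.1 hp
  have hf : fracPart p.1 ∈ cK k := sub_intPart_mem_cK h₁' _
  exact mem_OmegaSet_iff.2
    ⟨⟨(one_lt_absInf_inv_iff (ne_zero_of_mem_cK hf)).2 (absInf_fracPart_lt_one _), inv_mem_cK hf⟩,
      absInf_inv_lt_one (one_lt_absInf_sub h₂ (one_lt_absInf_intPart_iff.2 h₁)),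
      inv_mem_cK (sub_intPart_mem_cK h₂' _)⟩

lemma PhiInv_PhiRaw {p : Khat k × Khat k} (hp : p ∈ OmegaSet k) : PhiInv (PhiRaw p) = p := by
  obtain ⟨⟨h₁, -⟩, -⟩ := mem_OmegaSet_iff.1 hp
  have h : intPart (p.1⁻¹ - intPart p.2⁻¹) = -intPart p.2⁻¹ := by
    rw [intPart_sub, intPart_intPart, intPart_eq_zero_iff.2 (absInf_inv_lt_one h₁), zero_sub]
  ext1 <;> simp [PhiInv, PhiRaw, fracPart, ArtinPsi, h]

lemma PhiRaw_PhiInv {p : Khat k × Khat k} (hp : p ∈ OmegaSet k) : PhiRaw (PhiInv p) = p := by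
  obtain ⟨-, h₂, -⟩ := mem_OmegaSet_iff.1 hp
  have h : intPart (p.2 - intPart p.1) = -intPart p.1 := by
    rw [intPart_sub, intPart_intPart, intPart_eq_zero_iff.2 h₂, zero_sub]
  ext1 <;> simp [PhiInv, PhiRaw, fracPart, ArtinPsi, h]

lemma continuousOn_PhiRaw : ContinuousOn (PhiRaw (k := k)) (OmegaSet k) := by
  intro p hp
  obtain ⟨⟨-, h₁⟩, -, h₂⟩ := mem_OmegaSet_iff.1 hp
  have c₁ : ContinuousAt (fun p : Khat k × Khat k => p.1⁻¹) p :=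
    (continuousAt_inv_Khat (ne_zero_of_mem_cK h₁)).comp continuousAt_fst
  have c₂ : ContinuousAt (fun p : Khat k × Khat k => p.2⁻¹) p :=
    (continuousAt_inv_Khat (ne_zero_of_mem_cK h₂)).comp continuousAt_snd
  exact ((continuous_sub_Khat.continuousAt.comp
    (c₁.prodMk (continuous_intPart.continuousAt.comp c₂))).prodMk
      (continuous_fracPart.continuousAt.comp c₂)).continuousWithinAt

lemma continuousOn_PhiInv : ContinuousOn (PhiInv (k := k)) (OmegaSet k) := by
  intro p hp
  obtain ⟨⟨-, h₁⟩, -, h₂⟩ := mem_OmegaSet_iff.1 hp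
  have c₁ : ContinuousAt (fun p : Khat k × Khat k => (fracPart p.1)⁻¹) p :=
    ContinuousAt.comp (f := fun p : Khat k × Khat k => fracPart p.1)
      (continuousAt_inv_Khat (ne_zero_of_mem_cK (sub_intPart_mem_cK h₁ _)))
      (continuous_fracPart.comp continuous_fst).continuousAt
  have c₂ : ContinuousAt (fun p : Khat k × Khat k => (p.2 - intPart p.1)⁻¹) p :=
    ContinuousAt.comp (f := fun p : Khat k × Khat k => p.2 - intPart p.1)
      (continuousAt_inv_Khat (ne_zero_of_mem_cK (sub_intPart_mem_cK h₂ _)))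
      (continuous_sub_Khat.comp
        (continuous_snd.prodMk (continuous_intPart.comp continuous_fst))).continuousAt
  exact (c₁.prodMk c₂).continuousWithinAt

variable (k) in
/-- The homeomorphism of `Ω` induced by `PhiRaw`. -/
def PhiHomeomorph : ↥(OmegaSet k) ≃ₜ ↥(OmegaSet k) where
  toFun p := ⟨PhiRaw p, PhiRaw_mem_OmegaSet p.2⟩
  invFun p := ⟨PhiInv p, PhiInv_mem_OmegaSet p.2⟩
  left_inv p := Subtype.ext (PhiInv_PhiRaw p.2)
  right_inv p := Subtype.ext (PhiRaw_PhiInv p.2)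
  continuous_toFun := continuousOn_PhiRaw.domRestrict.subtype_mk _
  continuous_invFun := continuousOn_PhiInv.domRestrict.subtype_mk _

end Phi

/-- `Φ` maps `Ω = (J ∩ ᶜK) × (X⁻¹O ∩ ᶜK)` into itself, and is a bijection of
`Ω` which is a homeomorphism for the topology induced by `d_∞ × d_∞`. -/
theorem statement_1 (k : Type*) [Field k] [Fintype k] :
    (∀ ξm ∈ Jset k ∩ cK k, ∀ ξp ∈ XinvO k ∩ cK k,
        ξm⁻¹ - intPart ξp⁻¹ ∈ Jset k ∩ cK k ∧ ArtinPsi ξp ∈ XinvO k ∩ cK k) ∧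
    (∀ p ∈ OmegaSet k, PhiRaw p ∈ OmegaSet k) ∧
    ∃ Φ : ↥(OmegaSet k) ≃ₜ ↥(OmegaSet k),
      ∀ ℓ : ↥(OmegaSet k), (Φ ℓ : Khat k × Khat k) = PhiRaw (ℓ : Khat k × Khat k) := by
  refine ⟨fun ξm hm ξp hp => ?_, fun p hp => PhiRaw_mem_OmegaSet hp, PhiHomeomorph k, fun _ => rfl⟩
  exact Set.mem_prod.1 (PhiRaw_mem_OmegaSet (p := (ξm, ξp)) ⟨hm, hp⟩)

end ArtinCoding
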